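/- Let ⟨∇₁,t₁⟩ and ⟨∇₂,t₂⟩ be two terms-in-context with disjoint sets of variables. Then ⟨∇₁,t₁⟩ and ⟨∇₂,t₂⟩ are joinable (i.e., there exists a term-in-context ⟨Γ,s⟩ with ⟨∇₁,t₁⟩ ⪯ ⟨Γ,s⟩ and ⟨∇₂,t₂⟩ ⪯ ⟨Γ,s⟩) if and only if the nominal unification problem {t₁ ≈? t₂} ∪ ∇₁ ∪ ∇₂ has a solution, i.e., there exist a freshness context Γ and a substitution σ such that Γ ⊢ t₁σ ≈ t₂σ and Γ ⊢ a # Xσ for every a#X ∈ ∇₁ ∪ ∇₂. -/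

import Mathlib

set_option maxHeartbeats 1000000
abbrev Atom := ℕ
abbrev Var := ℕ
abbrev Fn := ℕ
abbrev NPerm := List (Atom × Atom)
def swapAtom (a b c : Atom) : Atom := if c = a then b else if c = b then a else c
def permAtom : NPerm → Atom → Atom
  | [], c => c
  | (a, b) :: π, c => swapAtom a b (permAtom π c)
def permInv (π : NPerm) : NPerm := π.reverse
inductive NTerm where
  | app : Fn → List NTerm → NTerm
  | atom : Atom → NTerm
  | abs : Atom → NTerm → NTerm
  | susp : NPerm → Var → NTerm

def permTerm (π : NPerm) : NTerm → NTerm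
  | .app f ts => .app f (ts.attach.map (fun x => permTerm π x.1))
  | .atom a => .atom (permAtom π a)
  | .abs a t => .abs (permAtom π a) (permTerm π t)
  | .susp ρ X => .susp (π ++ ρ) X
decreasing_by
  all_goals (simp_wf; try omega)
  all_goals (have := List.sizeOf_lt_of_mem x.2; omega)

/-- Substitutions (total maps from variables to terms; identity almost everywhere
is not required for the statements). -/
abbrev NSubst := Var → NTerm

def idSubst : NSubst := fun X => .susp [] X

/-- Application of a substitution to a term (allowing atom capture and forcing
suspended permutations). -/
def substTerm (σ : NSubst) : NTerm → NTerm
  | .app f ts => .app f (ts.attach.map (fun x => substTerm σ x.1))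
  | .atom a => .atom a
  | .abs a t => .abs a (substTerm σ t)
  | .susp π X => permTerm π (σ X)
decreasing_by
  all_goals (simp_wf; try omega)
  all_goals (have := List.sizeOf_lt_of_mem x.2; omega)

/-- Composition of substitutions: `t (σθ) = (tσ)θ`. -/
def substComp (σ θ : NSubst) : NSubst := fun X => substTerm θ (σ X)

/-- Freshness contexts: finite sets of constraints `a # X`. -/
abbrev FCtx := Finset (Atom × Var)

/-- The freshness relation `Δ ⊢ a # t` (Urban–Pitts–Gabbay rules), stated for an
arbitrary set of freshness constraints. -/
inductive NFresh (Δ : Set (Atom × Var)) : Atom → NTerm → Prop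
  | atom {a b : Atom} : a ≠ b → NFresh Δ a (.atom b)
  | susp {a : Atom} {π : NPerm} {X : Var} :
      (permAtom (permInv π) a, X) ∈ Δ → NFresh Δ a (.susp π X)
  | app {a : Atom} {f : Fn} {ts : List NTerm} :
      (∀ t ∈ ts, NFresh Δ a t) → NFresh Δ a (.app f ts)
  | abs1 {a : Atom} {t : NTerm} : NFresh Δ a (.abs a t)
  | abs2 {a b : Atom} {t : NTerm} : a ≠ b → NFresh Δ a t → NFresh Δ a (.abs b t)

/-- The α-equivalence relation `Δ ⊢ t ≈ s` (Urban–Pitts–Gabbay rules). -/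
inductive NAlpha (Δ : Set (Atom × Var)) : NTerm → NTerm → Prop
  | atom (a : Atom) : NAlpha Δ (.atom a) (.atom a)
  | abs1 {a : Atom} {t t' : NTerm} : NAlpha Δ t t' → NAlpha Δ (.abs a t) (.abs a t')
  | abs2 {a b : Atom} {t t' : NTerm} : a ≠ b → NAlpha Δ t (permTerm [(a, b)] t') →
      NFresh Δ a t' → NAlpha Δ (.abs a t) (.abs b t')
  | susp {π π' : NPerm} {X : Var} :
      (∀ a : Atom, permAtom π a ≠ permAtom π' a → (a, X) ∈ Δ) →
      NAlpha Δ (.susp π X) (.susp π' X)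
  | app {f : Fn} {ts ss : List NTerm} : ts.length = ss.length →
      (∀ p ∈ List.zip ts ss, NAlpha Δ p.1 p.2) →
      NAlpha Δ (.app f ts) (.app f ss)

/-- `FA⁻ˢ(t)`: atoms occurring freely in `t`, ignoring suspensions. -/
def FAnoSusp : NTerm → Finset Atom
  | .app _ ts => (ts.attach.map (fun x => FAnoSusp x.1)).foldr (· ∪ ·) ∅
  | .atom a => {a}
  | .abs a t => FAnoSusp t \ {a}
  | .susp _ _ => ∅
decreasing_by
  all_goals (simp_wf; try omega)
  all_goals (have := List.sizeOf_lt_of_mem x.2; omega)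

/-- A substitution respects a freshness context. -/
def Respects (σ : NSubst) (Δ : FCtx) : Prop :=
  ∀ a X, (a, X) ∈ Δ → a ∉ FAnoSusp (σ X)

/-! ### The algorithm FC -/

/-- A finite set of atomic freshness formulas `a # t`. -/
abbrev FProb := Multiset (Atom × NTerm)

/-- One step of the algorithm FC, transforming pairs `(F; Δ)`. -/
inductive FCStep : FProb × FCtx → FProb × FCtx → Prop
  | del {a b : Atom} {F : FProb} {Δ : FCtx} : a ≠ b →
      FCStep ((a, .atom b) ::ₘ F, Δ) (F, Δ)
  | abs1 {a : Atom} {t : NTerm} {F : FProb} {Δ : FCtx} :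
      FCStep ((a, .abs a t) ::ₘ F, Δ) (F, Δ)
  | abs2 {a b : Atom} {t : NTerm} {F : FProb} {Δ : FCtx} : a ≠ b →
      FCStep ((a, .abs b t) ::ₘ F, Δ) ((a, t) ::ₘ F, Δ)
  | dec {a : Atom} {f : Fn} {ts : List NTerm} {F : FProb} {Δ : FCtx} :
      FCStep ((a, .app f ts) ::ₘ F, Δ) (↑(ts.map (fun t => (a, t))) + F, Δ)
  | sus {a : Atom} {π : NPerm} {X : Var} {F : FProb} {Δ : FCtx} :
      FCStep ((a, .susp π X) ::ₘ F, Δ) (F, insert (permAtom (permInv π) a, X) Δ)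

/-- The algorithm FC succeeds on `F` with result `Γ`. -/
def FCReaches (F : FProb) (Γ : FCtx) : Prop :=
  Relation.ReflTransGen FCStep (F, ∅) (0, Γ)

/-- The algorithm FC fails on `F` (reaches a stuck state with remaining formulas). -/
def FCFails (F : FProb) : Prop :=
  ∃ st : FProb × FCtx, Relation.ReflTransGen FCStep (F, ∅) st ∧ st.1 ≠ 0 ∧
    ∀ st', ¬ FCStep st st'

/-- The freshness problem `{a # Xσ | a#X ∈ Δ}` defining the instance `Δσ`. -/
def ctxSubstProb (Δ : FCtx) (σ : NSubst) : FProb :=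
  Δ.val.map (fun c => (c.1, σ c.2))

/-! ### Terms-in-context and the subsumption order -/

/-- A term-in-context. -/
abbrev TIC := FCtx × NTerm

/-- `p ⪯ q`: the term-in-context `p` is more general than `q`.  (The condition
`p.1 σ ⊆ q.1` is expressed, equivalently by the properties of FC, as
`q.1 ⊢ a # Xσ` for all `a # X ∈ p.1`.) -/
def TIC.Le (p q : TIC) : Prop :=
  ∃ σ : NSubst, Respects σ p.1 ∧
    (∀ c ∈ p.1, NFresh (↑q.1 : Set (Atom × Var)) c.1 (σ c.2)) ∧
    NAlpha (↑q.1 : Set (Atom × Var)) (substTerm σ p.2) q.2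

/-- The strict part of `⪯`. -/
def TIC.Lt (p q : TIC) : Prop := TIC.Le p q ∧ ¬ TIC.Le q p

/-- Equi-generality `≃`. -/
def TIC.Equiv (p q : TIC) : Prop := TIC.Le p q ∧ TIC.Le q p

/-- `r` is a generalization of `p₁` and `p₂`. -/
def IsGen (r p₁ p₂ : TIC) : Prop := TIC.Le r p₁ ∧ TIC.Le r p₂

/-! ### Atoms, variables, basedness -/

def permAtoms : NPerm → Finset Atom
  | [] => ∅
  | (a, b) :: π => insert a (insert b (permAtoms π))

def termAtoms : NTerm → Finset Atom
  | .app _ ts => (ts.attach.map (fun x => termAtoms x.1)).foldr (· ∪ ·) ∅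
  | .atom a => {a}
  | .abs a t => insert a (termAtoms t)
  | .susp π _ => permAtoms π
decreasing_by
  all_goals (simp_wf; try omega)
  all_goals (have := List.sizeOf_lt_of_mem x.2; omega)

def termVars : NTerm → Finset Var
  | .app _ ts => (ts.attach.map (fun x => termVars x.1)).foldr (· ∪ ·) ∅
  | .atom _ => ∅
  | .abs _ t => termVars t
  | .susp _ X => {X}
decreasing_by
  all_goals (simp_wf; try omega)
  all_goals (have := List.sizeOf_lt_of_mem x.2; omega)

/-- `FA(t)`: the atoms occurring freely in `t` (with `FA(π·X) = Atoms(π)`). -/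
def termFA : NTerm → Finset Atom
  | .app _ ts => (ts.attach.map (fun x => termFA x.1)).foldr (· ∪ ·) ∅
  | .atom a => {a}
  | .abs a t => termFA t \ {a}
  | .susp π _ => permAtoms π
decreasing_by
  all_goals (simp_wf; try omega)
  all_goals (have := List.sizeOf_lt_of_mem x.2; omega)

def ctxAtoms (Δ : FCtx) : Finset Atom := Δ.image Prod.fst
def ctxVars (Δ : FCtx) : Finset Var := Δ.image Prod.snd

def permBased (π : NPerm) (A : Finset Atom) : Prop := permAtoms π ⊆ A
def termBased (t : NTerm) (A : Finset Atom) : Prop := termAtoms t ⊆ A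
def ctxBased (Δ : FCtx) (A : Finset Atom) : Prop := ctxAtoms Δ ⊆ A
def ticBased (p : TIC) (A : Finset Atom) : Prop := ctxBased p.1 A ∧ termBased p.2 A

/-- The number of abstraction occurrences in a term. -/
def absCount : NTerm → ℕ
  | .app _ ts => (ts.attach.map (fun x => absCount x.1)).sum
  | .atom _ => 0
  | .abs _ t => absCount t + 1
  | .susp _ _ => 0
decreasing_by
  all_goals (simp_wf; try omega)
  all_goals (have := List.sizeOf_lt_of_mem x.2; omega)

/-! ### The nominal anti-unification algorithm 𝔑 -/

/-- Anti-unification triple `X : t ≜ s`. -/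
abbrev AUT := Var × NTerm × NTerm

/-- A state of the algorithm 𝔑: the unsolved triples `P`, the store `S`, the
freshness context `Γ`, the substitution `σ`, and the set `V` of variables used
so far (needed to express freshness of the generated variables). -/
structure NState where
  P : Multiset AUT
  S : Multiset AUT
  Γ : FCtx
  σ : NSubst
  V : Finset Var

/-- `σ{X ↦ u}`. -/
def updSubst (σ : NSubst) (X : Var) (u : NTerm) : NSubst :=
  substComp σ (fun Z => if Z = X then u else .susp [] Z)

/-- The head of a term (a function symbol together with its arity, an atom, the
abstraction operator, or a variable). -/
inductive NHead where
  | fn : Fn → ℕ → NHead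
  | atom : Atom → NHead
  | abs : NHead
  | var : Var → NHead
deriving DecidableEq

def headOf : NTerm → NHead
  | .app f ts => .fn f ts.length
  | .atom a => .atom a
  | .abs _ _ => .abs
  | .susp _ X => .var X

def IsSusp : NTerm → Prop
  | .susp _ _ => True
  | _ => False

def IsAbs : NTerm → Prop
  | .abs _ _ => True
  | _ => False

/-- The applicability condition of the rule Sol. -/
def SolCond (A : Finset Atom) (Δ : FCtx) (t s : NTerm) : Prop :=
  headOf t ≠ headOf s ∨ (IsSusp t ∧ IsSusp s) ∨
    (IsAbs t ∧ IsAbs s ∧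
      ¬ ∃ c ∈ A, NFresh (↑Δ : Set (Atom × Var)) c t ∧ NFresh (↑Δ : Set (Atom × Var)) c s)

open Classical in
/-- `{a # X | a ∈ A, Δ ⊢ a # t, Δ ⊢ a # s}`. -/
noncomputable def solSet (A : Finset Atom) (Δ : FCtx) (t s : NTerm) (X : Var) : FCtx :=
  (A.filter (fun a =>
    NFresh (↑Δ : Set (Atom × Var)) a t ∧ NFresh (↑Δ : Set (Atom × Var)) a s)).image
    (fun a => (a, X))

/-- `Γ{Y ↦ π·X}` on a freshness context. -/
def ctxRename (Γ : FCtx) (Y : Var) (π : NPerm) (X : Var) : FCtx :=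
  Γ.image (fun c => if c.2 = Y then (permAtom (permInv π) c.1, X) else c)

/-- One step of the algorithm 𝔑, with global parameters `A` and `Δ`. -/
inductive NStep (A : Finset Atom) (Δ : FCtx) : NState → NState → Prop
  | decApp {X : Var} {f : Fn} {ts ss : List NTerm} {P S : Multiset AUT} {Γ : FCtx}
      {σ : NSubst} {V : Finset Var} (Ys : List Var) :
      ts.length = ss.length → Ys.length = ts.length → Ys.Nodup →
      (∀ Y ∈ Ys, Y ∉ V) →
      NStep A Δ ⟨(X, .app f ts, .app f ss) ::ₘ P, S, Γ, σ, V⟩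
        ⟨↑(List.zipWith (fun Y p => (Y, p)) Ys (List.zip ts ss)) + P, S, Γ,
         updSubst σ X (.app f (Ys.map (fun Y => .susp [] Y))), V ∪ Ys.toFinset⟩
  | decAtom {X : Var} {a : Atom} {P S : Multiset AUT} {Γ : FCtx} {σ : NSubst}
      {V : Finset Var} :
      NStep A Δ ⟨(X, .atom a, .atom a) ::ₘ P, S, Γ, σ, V⟩
        ⟨P, S, Γ, updSubst σ X (.atom a), V⟩
  | abs {X : Var} {a b : Atom} {t s : NTerm} {P S : Multiset AUT} {Γ : FCtx}
      {σ : NSubst} {V : Finset Var} (Y : Var) (c : Atom) :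
      Y ∉ V → c ∈ A →
      NFresh (↑Δ : Set (Atom × Var)) c (.abs a t) →
      NFresh (↑Δ : Set (Atom × Var)) c (.abs b s) →
      NStep A Δ ⟨(X, .abs a t, .abs b s) ::ₘ P, S, Γ, σ, V⟩
        ⟨(Y, permTerm [(c, a)] t, permTerm [(c, b)] s) ::ₘ P, S, Γ,
         updSubst σ X (.abs c (.susp [] Y)), insert Y V⟩
  | sol {X : Var} {t s : NTerm} {P S : Multiset AUT} {Γ : FCtx} {σ : NSubst}
      {V : Finset Var} :
      SolCond A Δ t s →
      NStep A Δ ⟨(X, t, s) ::ₘ P, S, Γ, σ, V⟩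
        ⟨P, (X, t, s) ::ₘ S, Γ ∪ solSet A Δ t s X, σ, V⟩
  | mer {X Y : Var} {t₁ s₁ t₂ s₂ : NTerm} {P S : Multiset AUT} {Γ : FCtx}
      {σ : NSubst} {V : Finset Var} (π : NPerm) :
      X ≠ Y →
      permBased π (termAtoms t₁ ∪ termAtoms s₁ ∪ termAtoms t₂ ∪ termAtoms s₂) →
      NAlpha (↑Δ : Set (Atom × Var)) (permTerm π t₁) t₂ →
      NAlpha (↑Δ : Set (Atom × Var)) (permTerm π s₁) s₂ →
      NStep A Δ ⟨P, (X, t₁, s₁) ::ₘ (Y, t₂, s₂) ::ₘ S, Γ, σ, V⟩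
        ⟨P, (X, t₁, s₁) ::ₘ S, ctxRename Γ Y π X, updSubst σ Y (.susp π X), V⟩

/-- The initial state of 𝔑 on the triple `X : t ≜ s`. -/
def initNState (X : Var) (t s : NTerm) (Δ : FCtx) : NState :=
  ⟨{(X, t, s)}, 0, ∅, idSubst, insert X (termVars t ∪ termVars s ∪ ctxVars Δ)⟩

/-- An `A`-based least general generalization of `p₁` and `p₂`. -/
def IsABasedLgg (A : Finset Atom) (p p₁ p₂ : TIC) : Prop :=
  ticBased p A ∧ IsGen p p₁ p₂ ∧
    ¬ ∃ p' : TIC, ticBased p' A ∧ IsGen p' p₁ p₂ ∧ TIC.Lt p p'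

/-! ### The equivariance algorithm 𝔈 -/

/-- A set of equivariance equations `t ≈ s`. -/
abbrev EProb := Multiset (NTerm × NTerm)

def eqsAtoms (E : EProb) : Finset Atom :=
  (E.map (fun e => termAtoms e.1 ∪ termAtoms e.2)).sup

def eqsVars (E : EProb) : Finset Var :=
  (E.map (fun e => termVars e.1 ∪ termVars e.2)).sup

/-- All equations of `E` are equations between atoms. -/
def AtomEqs (E : EProb) : Prop := ∀ e ∈ E, ∃ a b : Atom, e = (NTerm.atom a, NTerm.atom b)

/-- One step of the equivariance algorithm 𝔈 (with fixed freshness context `Δ`) on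
states `(E; A; π)`.  The first-phase rules require `π = Id`; the second-phase
rules require that only equations between atoms are left. -/
inductive EStep (Δ : FCtx) :
    EProb × Finset Atom × NPerm → EProb × Finset Atom × NPerm → Prop
  | dec {f : Fn} {ts ss : List NTerm} {E : EProb} {A : Finset Atom} :
      ts.length = ss.length →
      EStep Δ ((.app f ts, .app f ss) ::ₘ E, A, []) (↑(List.zip ts ss) + E, A, [])
  | alp {a b : Atom} {t s : NTerm} {E : EProb} {A : Finset Atom} (c : Atom) :
      c ∉ A → c ∉ eqsAtoms ((.abs a t, .abs b s) ::ₘ E) → c ∉ ctxAtoms Δ →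
      EStep Δ ((.abs a t, .abs b s) ::ₘ E, A, [])
        ((permTerm [(c, a)] t, permTerm [(c, b)] s) ::ₘ E, A, [])
  | sus {π₁ π₂ : NPerm} {X : Var} {E : EProb} {A : Finset Atom} :
      EStep Δ ((.susp π₁ X, .susp π₂ X) ::ₘ E, A, [])
        (↑((A.filter (fun a => (a, X) ∉ Δ)).toList.map
            (fun a => (NTerm.atom (permAtom π₁ a), NTerm.atom (permAtom π₂ a)))) + E,
         A, [])
  | rem {a b : Atom} {E : EProb} {A : Finset Atom} {π : NPerm} :
      AtomEqs ((.atom a, .atom b) ::ₘ E) → permAtom π a = b →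
      EStep Δ ((.atom a, .atom b) ::ₘ E, A, π) (E, A.erase b, π)
  | sol {a b : Atom} {E : EProb} {A : Finset Atom} {π : NPerm} :
      AtomEqs ((.atom a, .atom b) ::ₘ E) →
      permAtom π a ∈ A → b ∈ A → permAtom π a ≠ b →
      EStep Δ ((.atom a, .atom b) ::ₘ E, A, π) (E, A.erase b, (permAtom π a, b) :: π)

/-! ### A denotational model of `α`-equivalence -/

@[elab_as_elim]
theorem NTerm.induct {P : NTerm → Prop}
    (app : ∀ f ts, (∀ t ∈ ts, P t) → P (.app f ts))
    (atom : ∀ a, P (.atom a)) (abs : ∀ a t, P t → P (.abs a t))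
    (susp : ∀ π X, P (.susp π X)) : ∀ t, P t
  | .app f ts => app f ts fun t _ => NTerm.induct app atom abs susp t
  | .atom a => atom a
  | .abs a t => abs a t (NTerm.induct app atom abs susp t)
  | .susp π X => susp π X

theorem swapAtom_swapAtom (a b c : Atom) : swapAtom a b (swapAtom a b c) = c := by
  unfold swapAtom
  split_ifs <;> simp_all

theorem permAtom_append (π ρ : NPerm) (c : Atom) :
    permAtom (π ++ ρ) c = permAtom π (permAtom ρ c) := by
  induction π with
  | nil => rfl
  | cons p π ih => simp [permAtom, ih]

theorem permAtom_permInv_permAtom (π : NPerm) (c : Atom) :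
    permAtom (permInv π) (permAtom π c) = c := by
  induction π with
  | nil => rfl
  | cons p π ih =>
    simpa [permInv, permAtom, permAtom_append, swapAtom_swapAtom] using ih

theorem permAtom_permAtom_permInv (π : NPerm) (c : Atom) :
    permAtom π (permAtom (permInv π) c) = c := by
  simpa [permInv] using permAtom_permInv_permAtom (permInv π) c

theorem permAtom_injective (π : NPerm) : Function.Injective (permAtom π) :=
  Function.LeftInverse.injective (permAtom_permInv_permAtom π)

/-- Denotations of nominal terms under Boolean valuations of atoms; a binder denotes a
function of the value of the bound atom. -/
inductive Denot where
  | app : Fn → List Denot → Denot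
  | atom : Bool → Denot
  | abs : (Bool → Denot) → Denot
  | susp : Var → (Atom → Option Bool) → Denot

open Classical in
/-- The denotation of a term under a valuation of atoms. Suspensions forget the values of the
atoms that are fresh for the variable. -/
noncomputable def denot (Δ : Set (Atom × Var)) (ρ : Atom → Bool) : NTerm → Denot
  | .app f ts => .app f (ts.attach.map fun x => denot Δ ρ x.1)
  | .atom a => .atom (ρ a)
  | .abs a t => .abs fun v => denot Δ (Function.update ρ a v) t
  | .susp π X => .susp X fun b => if (b, X) ∈ Δ then none else some (ρ (permAtom π b))
decreasing_by
  all_goals (simp_wf; try omega)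
  all_goals (have := List.sizeOf_lt_of_mem x.2; omega)

theorem denot_app (Δ : Set (Atom × Var)) (ρ : Atom → Bool) (f : Fn) (ts : List NTerm) :
    denot Δ ρ (.app f ts) = .app f (ts.map (denot Δ ρ)) := by
  rw [denot, List.attach_map_val (f := denot Δ ρ)]

theorem permTerm_app (π : NPerm) (f : Fn) (ts : List NTerm) :
    permTerm π (.app f ts) = .app f (ts.map (permTerm π)) := by
  rw [permTerm, List.attach_map_val (f := permTerm π)]

theorem substTerm_app (σ : NSubst) (f : Fn) (ts : List NTerm) :
    substTerm σ (.app f ts) = .app f (ts.map (substTerm σ)) := by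
  rw [substTerm, List.attach_map_val (f := substTerm σ)]

theorem mem_foldr_union {α β : Type*} [DecidableEq β] (g : α → Finset β) (l : List α) (b : β) :
    b ∈ (l.map g).foldr (· ∪ ·) ∅ ↔ ∃ x ∈ l, b ∈ g x := by
  induction l <;> simp_all

theorem mem_FAnoSusp_app {f : Fn} {ts : List NTerm} {a : Atom} :
    a ∈ FAnoSusp (.app f ts) ↔ ∃ t ∈ ts, a ∈ FAnoSusp t := by
  rw [FAnoSusp, List.attach_map_val (f := FAnoSusp), mem_foldr_union]

theorem mem_termVars_app {f : Fn} {ts : List NTerm} {X : Var} :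
    X ∈ termVars (.app f ts) ↔ ∃ t ∈ ts, X ∈ termVars t := by
  rw [termVars, List.attach_map_val (f := termVars), mem_foldr_union]

theorem denot_permTerm (Δ : Set (Atom × Var)) (π : NPerm) (t : NTerm) (ρ : Atom → Bool) :
    denot Δ ρ (permTerm π t) = denot Δ (ρ ∘ permAtom π) t := by
  induction t using NTerm.induct generalizing ρ with
  | app f ts ih =>
    simp only [permTerm_app, denot_app, List.map_map, Denot.app.injEq, true_and]
    exact List.map_congr_left fun t ht => ih t ht ρ
  | atom a => simp [permTerm, denot]
  | abs a t ih =>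
    simp only [permTerm, denot, ih,
      Function.update_comp_eq_of_injective ρ (permAtom_injective π)]
  | susp π' X => simp [permTerm, denot, permAtom_append]

theorem denot_eq_iff_fresh (Δ : Set (Atom × Var)) (t : NTerm) (ρ ρ' : Atom → Bool) :
    denot Δ ρ t = denot Δ ρ' t ↔ ∀ a, ρ a ≠ ρ' a → NFresh Δ a t := by
  induction t using NTerm.induct generalizing ρ ρ' with
  | app f ts ih =>
    simp only [denot_app, Denot.app.injEq, true_and, List.map_inj_left]
    constructor
    · intro h a ha
      exact .app fun t ht => (ih t ht ρ ρ').1 (h t ht) a ha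
    · intro h t ht
      refine (ih t ht ρ ρ').2 fun a ha => ?_
      cases h a ha with
      | app h => exact h t ht
  | atom b =>
    simp only [denot, Denot.atom.injEq]
    constructor
    · rintro h a ha
      exact .atom fun hab => ha (hab ▸ h)
    · intro h
      by_contra hb
      cases h b hb with
      | atom h => exact h rfl
  | abs b t ih =>
    simp only [denot, Denot.abs.injEq, funext_iff, ih]
    constructor
    · intro h a ha
      by_cases hab : a = b
      · exact hab ▸ .abs1
      · exact .abs2 hab (h true a (by simpa [Function.update_of_ne hab] using ha))
    · intro h v a ha
      have hab : a ≠ b := by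
        rintro rfl
        simp at ha
      rw [Function.update_of_ne hab, Function.update_of_ne hab] at ha
      cases h a ha with
      | abs1 => exact absurd rfl hab
      | abs2 _ h => exact h
  | susp π X =>
    simp only [denot, Denot.susp.injEq, true_and, funext_iff]
    constructor
    · intro h a ha
      refine .susp ?_
      by_contra hm
      have := h (permAtom (permInv π) a)
      simp [hm, permAtom_permAtom_permInv] at this
      exact ha this
    · intro h b
      split_ifs with hm
      · rfl
      · refine congrArg some ?_
        by_contra hb
        cases h _ hb with
        | susp h => exact hm (by simpa [permAtom_permInv_permAtom] using h)

theorem denot_update_swap {Δ : Set (Atom × Var)} {a b : Atom} {t : NTerm} (h : NFresh Δ a t)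
    (ρ : Atom → Bool) :
    denot Δ ρ (permTerm [(a, b)] t) = denot Δ (Function.update ρ b (ρ a)) t := by
  rw [denot_permTerm, denot_eq_iff_fresh]
  intro c hc
  have hca : c = a := by
    by_contra hca
    apply hc
    by_cases hcb : c = b <;> simp_all [permAtom, swapAtom]
  exact hca ▸ h

theorem NAlpha.denot_eq {Δ : Set (Atom × Var)} {t s : NTerm} (h : NAlpha Δ t s)
    (ρ : Atom → Bool) : denot Δ ρ t = denot Δ ρ s := by
  induction h generalizing ρ with
  | atom a => rfl
  | abs1 _ ih => simp only [denot, ih]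
  | @abs2 a b t t' hab _ hf ih =>
    simp only [denot, Denot.abs.injEq]
    funext v
    rw [ih, denot_update_swap hf, Function.update_self, denot_eq_iff_fresh]
    intro c hc
    have hca : c = a := by
      by_contra hca
      apply hc
      by_cases hcb : c = b <;> simp_all
    exact hca ▸ hf
  | @susp π π' X h =>
    simp only [denot, Denot.susp.injEq, true_and]
    funext b
    split_ifs with hm
    · rfl
    · rw [not_imp_comm.1 (h b) hm]
  | @app f ts ss hl _ ih =>
    simp only [denot_app, Denot.app.injEq, true_and]
    refine List.ext_getElem (by simpa using hl) fun i h₁ h₂ => ?_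
    simp only [List.length_map] at h₁ h₂
    simpa using ih (ts[i], ss[i])
      (List.mem_iff_getElem.2 ⟨i, by simp [h₁, h₂], by simp⟩) ρ

theorem NAlpha.of_denot_eq {Δ : Set (Atom × Var)} {t s : NTerm}
    (h : ∀ ρ, denot Δ ρ t = denot Δ ρ s) : NAlpha Δ t s := by
  induction t using NTerm.induct generalizing s with
  | app f ts ih =>
    cases s with
    | app g ss =>
      simp only [denot_app, Denot.app.injEq] at h
      obtain rfl := (h fun _ => true).1
      have hl : ts.length = ss.length := by
        simpa using congrArg List.length (h fun _ => true).2
      refine .app hl fun p hp => ?_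
      obtain ⟨i, hi, rfl⟩ := List.mem_iff_getElem.1 hp
      simp only [List.length_zip, lt_inf_iff] at hi
      simp only [List.getElem_zip]
      refine ih _ (List.getElem_mem _) fun ρ => ?_
      have := congrArg (fun l => l[i]?) (h ρ).2
      simpa [hi.1, hi.2] using this
    | _ => simp [denot_app, denot] at h
  | atom a =>
    cases s with
    | atom b =>
      simp only [denot, Denot.atom.injEq] at h
      have hab : b = a := by simpa using h fun c => decide (c = a)
      exact hab ▸ .atom b
    | _ => simp [denot_app, denot] at h
  | abs a t ih =>
    cases s with
    | abs b s =>
      simp only [denot, Denot.abs.injEq, funext_iff] at h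
      by_cases hab : a = b
      · subst hab
        exact .abs1 (ih fun ρ => by simpa using h ρ (ρ a))
      · have hf : NFresh Δ a s := by
          have e := h (fun _ => false) false
          have e' := h (Function.update (fun _ => false) a true) false
          rw [Function.update_idem] at e'
          refine (denot_eq_iff_fresh Δ s _ _).1 (e.symm.trans e') a ?_
          simp [Function.update_of_ne hab]
        refine .abs2 hab (ih fun ρ => ?_) hf
        rw [denot_update_swap hf]
        simpa using h ρ (ρ a)
    | _ => simp [denot_app, denot] at h
  | susp π X =>
    cases s with
    | susp π' Y =>
      simp only [denot, Denot.susp.injEq, funext_iff] at h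
      obtain rfl := (h fun _ => true).1
      refine .susp fun b hb => ?_
      by_contra hm
      have := (h fun c => decide (c = permAtom π b)).2 b
      simp [hm] at this
      exact hb this.symm
    | _ => simp [denot_app, denot] at h

theorem NAlpha.refl (Δ : Set (Atom × Var)) (t : NTerm) : NAlpha Δ t t :=
  .of_denot_eq fun _ => rfl

theorem NAlpha.symm {Δ : Set (Atom × Var)} {t s : NTerm} (h : NAlpha Δ t s) : NAlpha Δ s t :=
  .of_denot_eq fun ρ => (h.denot_eq ρ).symm

theorem NAlpha.trans {Δ : Set (Atom × Var)} {t s u : NTerm} (h : NAlpha Δ t s)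
    (h' : NAlpha Δ s u) : NAlpha Δ t u :=
  .of_denot_eq fun ρ => (h.denot_eq ρ).trans (h'.denot_eq ρ)

theorem NFresh.notMem_FAnoSusp {Δ : Set (Atom × Var)} {a : Atom} {t : NTerm}
    (h : NFresh Δ a t) : a ∉ FAnoSusp t := by
  induction h with
  | app _ ih => simpa [mem_FAnoSusp_app] using ih
  | _ => simp_all [FAnoSusp]

theorem substTerm_congr {σ τ : NSubst} {t : NTerm} (h : ∀ X ∈ termVars t, σ X = τ X) :
    substTerm σ t = substTerm τ t := by
  induction t using NTerm.induct with
  | app f ts ih =>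
    simp only [substTerm_app, NTerm.app.injEq, true_and]
    exact List.map_congr_left fun t ht =>
      ih t ht fun X hX => h X (mem_termVars_app.2 ⟨t, ht, hX⟩)
  | atom a => simp [substTerm]
  | abs a t ih =>
    simp only [substTerm]
    rw [ih fun X hX => h X (by simpa [termVars] using hX)]
  | susp π X =>
    simp only [substTerm]
    rw [h X (by simp [termVars])]

/-- two terms-in-context with disjoint sets of variables are
joinable iff the nominal unification problem `{t₁ ≈? t₂} ∪ Δ₁ ∪ Δ₂` has a
solution `⟨Γ, σ⟩`. -/
theorem joinable_iff_unifiable (Δ₁ Δ₂ : FCtx) (t₁ t₂ : NTerm)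
    (hdisj : Disjoint (termVars t₁ ∪ ctxVars Δ₁) (termVars t₂ ∪ ctxVars Δ₂)) :
    (∃ q : TIC, TIC.Le (Δ₁, t₁) q ∧ TIC.Le (Δ₂, t₂) q) ↔
      ∃ (Γ : FCtx) (σ : NSubst),
        NAlpha (↑Γ : Set (Atom × Var)) (substTerm σ t₁) (substTerm σ t₂) ∧
        ∀ c ∈ Δ₁ ∪ Δ₂, NFresh (↑Γ : Set (Atom × Var)) c.1 (σ c.2) := by
  constructor
  · rintro ⟨⟨Γ, s⟩, ⟨σ₁, -, hf₁, ha₁⟩, ⟨σ₂, -, hf₂, ha₂⟩⟩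
    let σ : NSubst := fun X => if X ∈ termVars t₁ ∪ ctxVars Δ₁ then σ₁ X else σ₂ X
    have h₁ : ∀ X ∈ termVars t₁ ∪ ctxVars Δ₁, σ X = σ₁ X := fun X hX => if_pos hX
    have h₂ : ∀ X ∈ termVars t₂ ∪ ctxVars Δ₂, σ X = σ₂ X := fun X hX =>
      if_neg (Finset.disjoint_right.1 hdisj hX)
    refine ⟨Γ, σ, ?_, fun c hc => ?_⟩
    · rw [substTerm_congr fun X hX => h₁ X (Finset.mem_union_left _ hX),
        substTerm_congr fun X hX => h₂ X (Finset.mem_union_left _ hX)]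
      exact ha₁.trans ha₂.symm
    · rcases Finset.mem_union.1 hc with hc | hc
      · rw [h₁ c.2 (Finset.mem_union_right _ (Finset.mem_image_of_mem _ hc))]
        exact hf₁ c hc
      · rw [h₂ c.2 (Finset.mem_union_right _ (Finset.mem_image_of_mem _ hc))]
        exact hf₂ c hc
  · rintro ⟨Γ, σ, ha, hf⟩
    have hf₁ := fun c hc => hf c (Finset.mem_union_left Δ₂ hc)
    have hf₂ := fun c hc => hf c (Finset.mem_union_right Δ₁ hc)
    exact ⟨(Γ, substTerm σ t₂),
      ⟨σ, fun a X h => (hf₁ (a, X) h).notMem_FAnoSusp, hf₁, ha⟩,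
      ⟨σ, fun a X h => (hf₂ (a, X) h).notMem_FAnoSusp, hf₂, .refl _ _⟩⟩
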